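/- For all integers k ≥ 3 and n with n > 4k, one has c(k) < o(n). (This expresses that the number of nilpotent orbits in a Lie algebra of type C_k is smaller than the number of nilpotent orbits in any classical simple Lie algebra having an irreducible module of dimension n > 4k.) -/

import Mathlib

/-- The number of partitions of `n`: multisets of positive integers with sum `n`. -/
noncomputable def numPartitions (n : ℕ) : ℕ :=
  Nat.card {l : Multiset ℕ // (∀ i ∈ l, 0 < i) ∧ l.sum = n}

/-- `a n` is the number of partitions of `n + 1`, i.e. the number of nilpotent
adjoint orbits in the simple complex Lie algebra of type `A_n`. -/
noncomputable def a (n : ℕ) : ℕ := numPartitions (n + 1)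

/-- `b m` is the number of pairs `(λ, μ)` of partitions with `2|λ| + |μ| = 2m + 1`
where the parts of `μ` are pairwise distinct and all odd; this is the number of
nilpotent adjoint orbits in type `B_m`. -/
noncomputable def b (m : ℕ) : ℕ :=
  Nat.card {p : Multiset ℕ × Multiset ℕ //
    (∀ i ∈ p.1, 0 < i) ∧ (∀ i ∈ p.2, 0 < i) ∧ p.2.Nodup ∧ (∀ i ∈ p.2, Odd i) ∧
    2 * p.1.sum + p.2.sum = 2 * m + 1}

/-- `c m` is the number of pairs `(λ, μ)` of partitions with `|λ| + |μ| = m`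
where the parts of `μ` are pairwise distinct; this is the number of
nilpotent adjoint orbits in type `C_m`. -/
noncomputable def c (m : ℕ) : ℕ :=
  Nat.card {p : Multiset ℕ × Multiset ℕ //
    (∀ i ∈ p.1, 0 < i) ∧ (∀ i ∈ p.2, 0 < i) ∧ p.2.Nodup ∧
    p.1.sum + p.2.sum = m}

/-- `d m` is the number of pairs `(λ, μ)` of partitions with `2|λ| + |μ| = 2m`
where the parts of `μ` are pairwise distinct and all odd; this is the number of
nilpotent adjoint orbits in type `D_m`. -/
noncomputable def d (m : ℕ) : ℕ :=
  Nat.card {p : Multiset ℕ × Multiset ℕ //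
    (∀ i ∈ p.1, 0 < i) ∧ (∀ i ∈ p.2, 0 < i) ∧ p.2.Nodup ∧ (∀ i ∈ p.2, Odd i) ∧
    2 * p.1.sum + p.2.sum = 2 * m}

/-- `o n` is the lower bound for the number of nilpotent adjoint orbits in a
classical simple Lie algebra having an (irreducible, self-dual as appropriate)
module of dimension `n`. -/
noncomputable def o (n : ℕ) : ℕ :=
  if Odd n then min (a (n - 1)) (b ((n - 1) / 2))
  else min (a (n - 1)) (min (c (n / 2)) (d (n / 2)))

theorem finite_multiset_pos_sum_le (N : ℕ) :
    {l : Multiset ℕ | (∀ i ∈ l, 0 < i) ∧ l.sum ≤ N}.Finite := by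
  have h : {l : Multiset ℕ | (∀ i ∈ l, 0 < i) ∧ l.sum ≤ N} ⊆
      ⋃ n ∈ Set.Iic N, Set.range (fun p : Nat.Partition n => p.parts) := by
    rintro l ⟨hpos, hsum⟩
    simp only [Set.mem_iUnion]
    exact ⟨l.sum, hsum, ⟨l, fun {i} hi => hpos i hi, rfl⟩, rfl⟩
  exact ((Set.finite_Iic N).biUnion fun n _ => Set.finite_range _).subset h

theorem finite_subtype_multiset_pair {P : Multiset ℕ × Multiset ℕ → Prop} (N : ℕ)
    (h : ∀ p, P p → ((∀ i ∈ p.1, 0 < i) ∧ p.1.sum ≤ N) ∧ (∀ i ∈ p.2, 0 < i) ∧ p.2.sum ≤ N) :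
    Finite {p // P p} :=
  Set.Finite.to_subtype (s := {p | P p})
    (((finite_multiset_pos_sum_le N).prod (finite_multiset_pos_sum_le N)).subset
      fun p hp => h p hp)

theorem finite_multiset_pos_sum_eq (n : ℕ) :
    Finite {l : Multiset ℕ // (∀ i ∈ l, 0 < i) ∧ l.sum = n} :=
  Set.Finite.to_subtype (s := {l : Multiset ℕ | (∀ i ∈ l, 0 < i) ∧ l.sum = n})
    ((finite_multiset_pos_sum_le n).subset fun _ hl => ⟨hl.1, hl.2.le⟩)

theorem numPartitions_mono : Monotone numPartitions := by
  intro m n hmn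
  have := finite_multiset_pos_sum_eq n
  refine Nat.card_le_card_of_injective
    (fun l => ⟨l.1 + Multiset.replicate (n - m) 1, ?_, ?_⟩) ?_
  · intro i hi
    rcases Multiset.mem_add.1 hi with hi | hi
    · exact l.2.1 i hi
    · rw [Multiset.eq_of_mem_replicate hi]
      exact one_pos
  · have := l.2.2
    simp only [Multiset.sum_add, Multiset.sum_replicate, smul_eq_mul]
    omega
  · intro l l' h
    exact Subtype.ext (add_right_cancel (congrArg Subtype.val h))

theorem numPartitions_le_b (m : ℕ) : numPartitions m ≤ b m := by
  have := finite_subtype_multiset_pair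
    (P := fun p => (∀ i ∈ p.1, 0 < i) ∧ (∀ i ∈ p.2, 0 < i) ∧ p.2.Nodup ∧
      (∀ i ∈ p.2, Odd i) ∧ 2 * p.1.sum + p.2.sum = 2 * m + 1) (2 * m + 1)
    fun p hp => ⟨⟨hp.1, by omega⟩, hp.2.1, by omega⟩
  refine Nat.card_le_card_of_injective
    (fun l => ⟨(l.1, {1}), l.2.1, by simp, by simp, by simp, by simp [l.2.2]⟩) ?_
  intro l l' h
  exact Subtype.ext (congrArg (fun x => x.1.1) h)

theorem numPartitions_le_c (m : ℕ) : numPartitions m ≤ c m := by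
  have := finite_subtype_multiset_pair
    (P := fun p => (∀ i ∈ p.1, 0 < i) ∧ (∀ i ∈ p.2, 0 < i) ∧ p.2.Nodup ∧
      p.1.sum + p.2.sum = m) m
    fun p hp => ⟨⟨hp.1, by omega⟩, hp.2.1, by omega⟩
  refine Nat.card_le_card_of_injective
    (fun l => ⟨(l.1, 0), l.2.1, by simp, by simp, by simp [l.2.2]⟩) ?_
  intro l l' h
  exact Subtype.ext (congrArg (fun x => x.1.1) h)

theorem numPartitions_le_d (m : ℕ) : numPartitions m ≤ d m := by
  have := finite_subtype_multiset_pair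
    (P := fun p => (∀ i ∈ p.1, 0 < i) ∧ (∀ i ∈ p.2, 0 < i) ∧ p.2.Nodup ∧
      (∀ i ∈ p.2, Odd i) ∧ 2 * p.1.sum + p.2.sum = 2 * m) (2 * m)
    fun p hp => ⟨⟨hp.1, by omega⟩, hp.2.1, by omega⟩
  refine Nat.card_le_card_of_injective
    (fun l => ⟨(l.1, 0), l.2.1, by simp, by simp, by simp, by simp [l.2.2]⟩) ?_
  intro l l' h
  exact Subtype.ext (congrArg (fun x => x.1.1) h)

/-- Double every part of the first partition and split the double `2 * j` of every part of the
second one as `(2 * j - 1) + 1`. -/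
def doubleSplit (p : Multiset ℕ × Multiset ℕ) : Multiset ℕ :=
  p.1.map (2 * ·) + (p.2.map (2 * · - 1) + Multiset.replicate (Multiset.card p.2) 1)

theorem pos_of_mem_doubleSplit {p : Multiset ℕ × Multiset ℕ} (h₁ : ∀ i ∈ p.1, 0 < i)
    (h₂ : ∀ i ∈ p.2, 0 < i) : ∀ i ∈ doubleSplit p, 0 < i := by
  intro i hi
  simp only [doubleSplit, Multiset.mem_add, Multiset.mem_map, Multiset.mem_replicate] at hi
  rcases hi with ⟨j, hj, rfl⟩ | ⟨j, hj, rfl⟩ | ⟨-, rfl⟩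
  · have := h₁ j hj
    omega
  · have := h₂ j hj
    omega
  · exact one_pos

theorem sum_doubleSplit {p : Multiset ℕ × Multiset ℕ} (h₂ : ∀ i ∈ p.2, 0 < i) :
    (doubleSplit p).sum = 2 * (p.1.sum + p.2.sum) := by
  have double_sum : ∀ l : Multiset ℕ, (l.map (2 * ·)).sum = 2 * l.sum := fun l => by
    simpa using Multiset.sum_map_mul_left (s := l) (a := 2) (f := id)
  have split_sum : (p.2.map (2 * · - 1)).sum + Multiset.card p.2 = 2 * p.2.sum := by
    rw [← double_sum, ← mul_one (Multiset.card p.2), ← smul_eq_mul, ← Multiset.sum_replicate,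
      ← Multiset.map_const', ← Multiset.sum_map_add]
    refine congrArg Multiset.sum (Multiset.map_congr rfl fun i hi => ?_)
    have := h₂ i hi
    omega
  simp only [doubleSplit, Multiset.sum_add, Multiset.sum_replicate, smul_eq_mul, mul_one,
    split_sum, double_sum, mul_add]

theorem filter_even_doubleSplit {p : Multiset ℕ × Multiset ℕ} (h₂ : ∀ i ∈ p.2, 0 < i) :
    (doubleSplit p).filter Even = p.1.map (2 * ·) := by
  rw [doubleSplit, Multiset.filter_add, Multiset.filter_eq_self.2, Multiset.filter_eq_nil.2,
    add_zero]
  · intro i hi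
    simp only [Multiset.mem_add, Multiset.mem_map, Multiset.mem_replicate] at hi
    rcases hi with ⟨j, hj, rfl⟩ | ⟨-, rfl⟩
    · have := h₂ j hj
      rw [Nat.even_iff]
      omega
    · decide
  · intro i hi
    obtain ⟨j, -, rfl⟩ := Multiset.mem_map.1 hi
    exact even_two_mul j

theorem doubleSplit_injOn : Set.InjOn doubleSplit {p | ∀ i ∈ p.2, 0 < i} := by
  rintro ⟨l, u⟩ hu ⟨l', u'⟩ hu' h
  have hl : l = l' := by
    have h' := congrArg (Multiset.filter Even) h
    rw [filter_even_doubleSplit hu, filter_even_doubleSplit hu'] at h'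
    exact Multiset.map_injective (fun x y hxy => by simpa using hxy) h'
  subst hl
  have h' := add_left_cancel (a := l.map (2 * ·)) h
  have hcard : Multiset.card u = Multiset.card u' := by
    have := congrArg Multiset.card h'
    simp only [Multiset.card_add, Multiset.card_map, Multiset.card_replicate] at this
    omega
  simp only [hcard] at h'
  have h'' := congrArg (Multiset.map fun x => (x + 1) / 2) (add_right_cancel h')
  have inv : ∀ v : Multiset ℕ, (∀ i ∈ v, 0 < i) →
      (v.map (2 * · - 1)).map (fun x => (x + 1) / 2) = v := by
    intro v hv
    rw [Multiset.map_map]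
    conv_rhs => rw [← Multiset.map_id v]
    refine Multiset.map_congr rfl fun i hi => ?_
    have := hv i hi
    simp only [Function.comp_apply, id]
    omega
  rw [inv u hu, inv u' hu'] at h''
  rw [h'']

theorem doubleSplit_ne_pair {k : ℕ} (hk : 3 ≤ k) (p : Multiset ℕ × Multiset ℕ) :
    doubleSplit p ≠ {3, 2 * k - 3} := by
  intro h
  have hcard : Multiset.card p.2 = 0 := by
    by_contra hne
    have : 1 ∈ doubleSplit p :=
      Multiset.mem_add.2 (.inr (Multiset.mem_add.2 (.inr (Multiset.mem_replicate.2 ⟨hne, rfl⟩))))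
    rw [h] at this
    simp only [Multiset.insert_eq_cons, Multiset.mem_cons, Multiset.mem_singleton] at this
    omega
  have : 3 ∈ doubleSplit p := by simp [h]
  rw [Multiset.card_eq_zero] at hcard
  simp only [doubleSplit, hcard, Multiset.map_zero, Multiset.card_zero, Multiset.replicate_zero,
    add_zero, Multiset.mem_map] at this
  obtain ⟨j, -, hj⟩ := this
  omega

theorem c_lt_numPartitions_two_mul {k : ℕ} (hk : 3 ≤ k) : c k < numPartitions (2 * k) := by
  have := finite_multiset_pos_sum_eq (2 * k)
  let f : {p : Multiset ℕ × Multiset ℕ //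
      (∀ i ∈ p.1, 0 < i) ∧ (∀ i ∈ p.2, 0 < i) ∧ p.2.Nodup ∧ p.1.sum + p.2.sum = k} →
      {l : Multiset ℕ // (∀ i ∈ l, 0 < i) ∧ l.sum = 2 * k} := fun p =>
    ⟨doubleSplit p.1, pos_of_mem_doubleSplit p.2.1 p.2.2.1, by
      rw [sum_doubleSplit p.2.2.1, p.2.2.2.2]⟩
  have hf : Function.Injective f := fun p q h =>
    Subtype.ext (doubleSplit_injOn p.2.2.1 q.2.2.1 (congrArg Subtype.val h))
  refine lt_of_le_of_ne (Nat.card_le_card_of_injective f hf) fun hcard => ?_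
  have hsurj : Function.Surjective f := (hf.bijective_of_nat_card_le hcard.ge).2
  obtain ⟨p, hp⟩ := hsurj ⟨{3, 2 * k - 3}, by
    intro i hi
    simp only [Multiset.insert_eq_cons, Multiset.mem_cons, Multiset.mem_singleton] at hi
    omega, by
    simp only [Multiset.insert_eq_cons, Multiset.sum_cons, Multiset.sum_singleton]
    omega⟩
  exact doubleSplit_ne_pair hk p.1 (congrArg Subtype.val hp)

theorem stmt_8 : ∀ k n : ℕ, 3 ≤ k → 4 * k < n → c k < o n := by
  intro k n hk hn
  have lt_of_le {m : ℕ} (hm : 2 * k ≤ m) : c k < numPartitions m :=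
    (c_lt_numPartitions_two_mul hk).trans_le (numPartitions_mono hm)
  have ha : c k < a (n - 1) := lt_of_le (by omega)
  unfold o
  split_ifs
  · exact lt_min ha ((lt_of_le (by omega)).trans_le (numPartitions_le_b _))
  · exact lt_min ha (lt_min ((lt_of_le (by omega)).trans_le (numPartitions_le_c _))
      ((lt_of_le (by omega)).trans_le (numPartitions_le_d _)))
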